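/- Let R be a ring and M a nonzero R-module. If M is compressible, then the following are equivalent: (1) for every nonzero submodule N of M there is no injective R-linear map from M into the quotient module M/N; (2) for every submodule N of M, every nonzero R-linear map f : N → M is injective. -/

import Mathlib

/-- For a nonzero compressible module `M`, the condition that `M` embeds in no
proper quotient `M ⧸ N` (for `N ≠ ⊥`) is equivalent to every nonzero partial endomorphism of
`M` being injective. -/
theorem stmt_0 {R M : Type*} [Ring R] [AddCommGroup M] [Module R M] [Nontrivial M]
    (hcomp : ∀ N : Submodule R M, N ≠ ⊥ → ∃ f : M →ₗ[R] N, Function.Injective f) :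
    (∀ N : Submodule R M, N ≠ ⊥ → ¬∃ f : M →ₗ[R] (M ⧸ N), Function.Injective f) ↔
      (∀ (N : Submodule R M) (f : N →ₗ[R] M), f ≠ 0 → Function.Injective f) := by
  constructor
  · intro h N f hf
    by_contra hinj
    have hk : LinearMap.ker f ≠ ⊥ := fun hk => hinj (LinearMap.ker_eq_bot.mp hk)
    have hr : LinearMap.range f ≠ ⊥ := fun hr => hf (LinearMap.range_eq_bot.mp hr)
    obtain ⟨e, he⟩ := hcomp _ hr
    have hK : (LinearMap.ker f).map N.subtype ≠ ⊥ := by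
      intro hK
      apply hk
      apply Submodule.map_injective_of_injective N.injective_subtype
      rw [hK, Submodule.map_bot]
    let j : (N ⧸ LinearMap.ker f) →ₗ[R] (M ⧸ (LinearMap.ker f).map N.subtype) :=
      (LinearMap.ker f).mapQ _ N.subtype (Submodule.le_comap_map _ _)
    have hj : Function.Injective j := by
      rw [injective_iff_map_eq_zero]
      intro x hx
      obtain ⟨y, rfl⟩ := Submodule.Quotient.mk_surjective _ x
      have hx' : (Submodule.Quotient.mk (y : M) : M ⧸ (LinearMap.ker f).map N.subtype) = 0 := hx
      rw [Submodule.Quotient.mk_eq_zero] at hx' ⊢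
      obtain ⟨z, hz, hzy⟩ := hx'
      have : z = y := Subtype.ext hzy
      exact this ▸ hz
    refine h _ hK ⟨j ∘ₗ f.quotKerEquivRange.symm.toLinearMap ∘ₗ e, ?_⟩
    exact hj.comp (f.quotKerEquivRange.symm.injective.comp he)
  · rintro h N hN ⟨g, hg⟩
    let E := LinearEquiv.ofInjective g hg
    let L := (LinearMap.range g).comap N.mkQ
    let p : L →ₗ[R] LinearMap.range g := N.mkQ.restrict (fun x hx => hx)
    let f : L →ₗ[R] M := E.symm.toLinearMap ∘ₗ p
    have hf : f ≠ 0 := by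
      intro h0
      obtain ⟨m, hm⟩ := exists_ne (0 : M)
      obtain ⟨x, hx⟩ := N.mkQ_surjective (g m)
      have hxL : x ∈ L := ⟨m, hx.symm⟩
      have h1 : f ⟨x, hxL⟩ = 0 := by rw [h0]; rfl
      have h2 : p ⟨x, hxL⟩ = 0 := E.symm.map_eq_zero_iff.mp h1
      have h3 : N.mkQ x = 0 := congrArg Subtype.val h2
      rw [hx] at h3
      exact hm (hg (h3.trans (map_zero g).symm))
    have hi := h L f hf
    obtain ⟨n, hn, hn0⟩ := Submodule.exists_mem_ne_zero_of_ne_bot hN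
    have hnq : N.mkQ n = 0 := (Submodule.Quotient.mk_eq_zero N).mpr hn
    have hnL : n ∈ L := ⟨0, by rw [hnq, map_zero]⟩
    have h1 : p ⟨n, hnL⟩ = 0 := Subtype.ext hnq
    have h2 : f ⟨n, hnL⟩ = 0 := E.symm.map_eq_zero_iff.mpr h1
    have h3 : (⟨n, hnL⟩ : L) = 0 := hi (h2.trans (map_zero f).symm)
    exact hn0 (congrArg Subtype.val h3)
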